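/- Let X be a real reflexive Banach space and A: X → X* pseudomonotone, bounded and coercive (⟨A(u),u⟩/‖u‖ → ∞ as ‖u‖ → ∞). Then A is surjective: for every b ∈ X* there exists u ∈ X with A(u) = b. -/

import Mathlib

open Filter Topology

lemma pm_lip_ext {E : Type*} [NormedAddCommGroup E] [NormedSpace ℝ E] (g : E → E) (K : NNReal)
    (hg : LipschitzOnWith K g (Metric.closedBall 0 1)) (h0 : ∀ x, 1 ≤ ‖x‖ → g x = 0) :
    LipschitzWith K g := by
  have key : ∀ x y : E, ‖x‖ ≤ 1 → 1 ≤ ‖y‖ → dist (g x) (g y) ≤ K * dist x y := by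
    intro x y hx hy
    have hc : ContinuousOn (fun s : ℝ => ‖x + s • (y - x)‖) (Set.Icc 0 1) := by fun_prop
    have := intermediate_value_Icc (zero_le_one) hc
    have h1 : (1 : ℝ) ∈ Set.Icc (‖x + (0:ℝ) • (y - x)‖) (‖x + (1:ℝ) • (y - x)‖) := by
      simp [hx, hy]
    obtain ⟨s, hs, hs1⟩ := this h1
    simp only at hs1
    set z := x + s • (y - x) with hz
    have hgz : g z = 0 := h0 z hs1.ge
    rw [h0 y hy, ← hgz]
    refine (hg.dist_le_mul x (by simpa using hx) z (by simp [hs1])).trans ?_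
    gcongr
    rw [dist_eq_norm, dist_eq_norm, hz]
    have : x - (x + s • (y - x)) = s • (x - y) := by module
    rw [this, norm_smul, Real.norm_eq_abs, abs_of_nonneg hs.1]
    exact mul_le_of_le_one_left (norm_nonneg _) hs.2
  refine LipschitzWith.of_dist_le_mul fun x y => ?_
  rcases le_total ‖x‖ 1 with hx | hx <;> rcases le_total ‖y‖ 1 with hy | hy
  · exact hg.dist_le_mul x (by simpa using hx) y (by simpa using hy)
  · exact key x y hx hy
  · rw [dist_comm, dist_comm x]; exact key y x hy hx
  · rw [h0 x hx, h0 y hy, dist_self]; positivity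

lemma pm_det_interp {E : Type*} [NormedAddCommGroup E] [NormedSpace ℝ E] [FiniteDimensional ℝ E]
    {d : ℕ} (hd : d = Module.finrank ℝ E) (v : Fin (d+1) → ℝ) (hv : Function.Injective v) :
    ∃ c : Fin (d+1) → ℝ, ∑ i, c i = 1 ∧
      ∀ M : E →L[ℝ] E,
        (ContinuousLinearMap.id ℝ _ + M).det
          = ∑ i, c i * (ContinuousLinearMap.id ℝ _ + v i • M).det := by
  classical
  refine ⟨fun i => (Lagrange.basis Finset.univ v i).eval 1, ?_, ?_⟩
  · rw [← Polynomial.eval_finsetSum, Lagrange.sum_basis hv.injOn Finset.univ_nonempty]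
    simp
  · intro M
    let b := Module.finBasisOfFinrankEq ℝ E hd.symm
    let A : Matrix (Fin d) (Fin d) ℝ := LinearMap.toMatrix b b M
    let P : Polynomial ℝ :=
      Matrix.det ((Polynomial.X : Polynomial ℝ) • A.map Polynomial.C
        + (1 : Matrix (Fin d) (Fin d) ℝ).map Polynomial.C)
    have hP : ∀ s : ℝ, (ContinuousLinearMap.id ℝ _ + s • M).det = P.eval s := by
      intro s
      have h1 : (ContinuousLinearMap.id ℝ _ + s • M).det = Matrix.det (1 + s • A) := by
        rw [ContinuousLinearMap.det, ← LinearMap.det_toMatrix b]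
        congr 1
        simp [A]
      rw [h1, ← Polynomial.coe_evalRingHom, RingHom.map_det]
      congr 1
      ext i j
      simp [Matrix.one_apply]
      split_ifs <;> simp [add_comm, mul_comm]
    have hdeg : P.degree < (Finset.univ : Finset (Fin (d+1))).card := by
      refine lt_of_le_of_lt Polynomial.degree_le_natDegree ?_
      have := Polynomial.natDegree_det_X_add_C_le A 1
      simp only [Fintype.card_fin, Finset.card_univ] at this ⊢
      exact_mod_cast Nat.lt_succ_of_le this
    have h := Lagrange.eq_interpolate (hv.injOn) hdeg
    have h1 := hP 1
    rw [one_smul] at h1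
    rw [h1, h, Lagrange.interpolate_apply, Polynomial.eval_finsetSum]
    refine Finset.sum_congr rfl fun i _ => ?_
    rw [hP]; simp [mul_comm]

open MeasureTheory in
theorem pm_no_retraction {E : Type*} [NormedAddCommGroup E] [InnerProductSpace ℝ E]
    [FiniteDimensional ℝ E] [MeasurableSpace E] [BorelSpace E] (μ : Measure E) [μ.IsAddHaarMeasure] (f : E → E)
    (K : NNReal) (hK : LipschitzOnWith K f (Metric.closedBall 0 1))
    (hd : ∀ x, ‖x‖ < 1 → DifferentiableAt ℝ f x)
    (h1 : ∀ x, ‖x‖ < 1 → ‖f x‖ = 1) (hS : ∀ x, ‖x‖ = 1 → f x = x) : False := by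
  classical
  obtain ⟨d, hdd⟩ : ∃ d, d = Module.finrank ℝ E := ⟨_, rfl⟩
  set U : Set E := Metric.ball 0 1 with hU
  have hUo : IsOpen U := Metric.isOpen_ball
  let g : E → E := fun x => if ‖x‖ < 1 then f x - x else 0
  have hgc : LipschitzOnWith (K + 1) g (Metric.closedBall 0 1) := by
    have := hK.sub (LipschitzWith.id.lipschitzOnWith (s := Metric.closedBall (0:E) 1))
    refine fun x hx y hy => ?_
    have e : ∀ x ∈ Metric.closedBall (0:E) 1, g x = f x - id x := by
      intro x hx
      simp only [g]
      split_ifs with h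
      · rfl
      · rw [hS x (le_antisymm (by simpa using hx) (not_lt.1 h))]; simp
    rw [e x hx, e y hy]
    exact this hx hy
  have hg0 : ∀ x, 1 ≤ ‖x‖ → g x = 0 := fun x hx => by simp [g, not_lt.2 hx]
  have hg : LipschitzWith (K+1) g := pm_lip_ext g _ hgc hg0
  have hgd : ∀ x ∈ U, HasFDerivAt g (fderiv ℝ f x - ContinuousLinearMap.id ℝ E) x := by
    intro x hx
    have hx' : ‖x‖ < 1 := by simpa [hU] using hx
    refine (((hd x hx').hasFDerivAt).sub (hasFDerivAt_id x)).congr_of_eventuallyEq ?_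
    filter_upwards [hUo.mem_nhds hx] with y hy
    have hy' : ‖y‖ < 1 := by simpa [hU] using hy
    simp [g, hy']
  let g' : E → E →L[ℝ] E := fun x => fderiv ℝ f x - ContinuousLinearMap.id ℝ E
  have hgn : ∀ x ∈ U, ‖g' x‖ ≤ K + 1 := by
    intro x hx
    have := (hgd x hx).le_of_lipschitz hg
    simpa using this
  obtain ⟨δ, hδ, hdet⟩ : ∃ δ > 0, ∀ L : E →L[ℝ] E, ‖L‖ < δ →
      0 < (ContinuousLinearMap.id ℝ E + L).det := by
    have hc : Continuous fun L : E →L[ℝ] E => (ContinuousLinearMap.id ℝ E + L).det :=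
      ContinuousLinearMap.continuous_det.comp (by fun_prop)
    have : ∀ᶠ L in 𝓝 (0 : E →L[ℝ] E), 0 < (ContinuousLinearMap.id ℝ E + L).det := by
      refine hc.continuousAt.eventually (lt_mem_nhds ?_)
      simp [ContinuousLinearMap.det]
    obtain ⟨δ, hδ, h⟩ := Metric.eventually_nhds_iff.1 this
    exact ⟨δ, hδ, fun L hL => h (by simpa using hL)⟩
  have hτ : ∃ τ > 0, ∀ t, 0 ≤ t → t < τ → t * (K + 1 : ℝ) < 1 ∧ t * (K+1 : ℝ) < δ := by
    have hK1 : (0:ℝ) < K + 1 := by positivity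
    refine ⟨min 1 δ / (K + 1), by positivity, fun t _ ht => ?_⟩
    rw [lt_div_iff₀ hK1] at ht
    exact lt_min_iff.1 ht
  obtain ⟨τ, hτ0, hτ⟩ := hτ
  have main : ∀ t, 0 ≤ t → t < τ →
      IntegrableOn (fun x => (ContinuousLinearMap.id ℝ E + t • g' x).det) U μ ∧
      ∫ x in U, (ContinuousLinearMap.id ℝ E + t • g' x).det ∂μ = μ.real U := by
    intro t ht0 ht
    obtain ⟨ht1, ht2⟩ := hτ t ht0 ht
    let F : E → E := fun x => x + t • g x
    have hlip : LipschitzWith (Real.toNNReal t * (K+1)) (fun x => t • g x) := by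
      refine LipschitzWith.of_dist_le_mul fun x y => ?_
      rw [dist_smul₀, Real.norm_eq_abs, abs_of_nonneg ht0]
      push_cast
      rw [Real.coe_toNNReal _ ht0, mul_assoc]
      have := hg.dist_le_mul x y
      push_cast at this
      gcongr
    have hlt : Real.toNNReal t * (K+1) < 1 := by
      rw [← NNReal.coe_lt_coe]; push_cast; rwa [Real.coe_toNNReal _ ht0]
    have hinj : Function.Injective F := by
      intro x y hxy
      by_contra hne
      have h2 : x - y = t • g y - t • g x := by
        have : x + t • g x = y + t • g y := hxy
        rw [sub_eq_sub_iff_add_eq_add, this, add_comm]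
      have h3 := hlip.dist_le_mul y x
      rw [dist_eq_norm, ← h2, ← dist_eq_norm, dist_comm y x] at h3
      have h4 : (0:ℝ) < dist x y := dist_pos.2 hne
      have h5 : ((Real.toNNReal t * (K+1) : NNReal) : ℝ) < 1 := by exact_mod_cast hlt
      nlinarith
    have hsurj : Function.Surjective F := by
      intro y
      have hcon : ContractingWith (Real.toNNReal t * (K+1)) (fun x => y - t • g x) := by
        refine ⟨hlt, ?_⟩
        refine LipschitzWith.of_dist_le_mul fun a b => ?_
        rw [dist_sub_left]
        exact hlip.dist_le_mul a b
      have := hcon.fixedPoint_isFixedPt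
      refine ⟨hcon.fixedPoint _, ?_⟩
      have h2 : y - t • g (hcon.fixedPoint _) = hcon.fixedPoint _ := this
      change hcon.fixedPoint _ + t • g (hcon.fixedPoint _) = y
      nth_rewrite 1 [← h2]
      simp
    have hFout : ∀ x, 1 ≤ ‖x‖ → F x = x := fun x hx => by simp [F, hg0 x hx]
    have himg : F '' U = U := by
      ext y
      constructor
      · rintro ⟨x, hx, rfl⟩
        by_contra hy
        have hy' : 1 ≤ ‖F x‖ := by simpa [hU] using hy
        have := hinj (hFout _ hy')
        rw [this] at hy
        exact hy hx
      · intro hy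
        obtain ⟨x, rfl⟩ := hsurj y
        refine ⟨x, ?_, rfl⟩
        by_contra hx
        have hx' : 1 ≤ ‖x‖ := by simpa [hU] using hx
        rw [hFout x hx'] at hy
        exact hx hy
    have hFd : ∀ x ∈ U, HasFDerivWithinAt F (ContinuousLinearMap.id ℝ E + t • g' x) U x := by
      intro x hx
      exact ((hasFDerivAt_id x).add ((hgd x hx).const_smul t)).hasFDerivWithinAt
    have hpos : ∀ x ∈ U, |(ContinuousLinearMap.id ℝ E + t • g' x).det| =
        (ContinuousLinearMap.id ℝ E + t • g' x).det := by
      intro x hx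
      refine abs_of_pos (hdet _ ?_)
      rw [norm_smul, Real.norm_eq_abs, abs_of_nonneg ht0]
      exact (mul_le_mul_of_nonneg_left (hgn x hx) ht0).trans_lt ht2
    have hI := integral_image_eq_integral_abs_det_fderiv_smul μ hUo.measurableSet hFd
      hinj.injOn (fun _ => (1:ℝ))
    have hI2 := integrableOn_image_iff_integrableOn_abs_det_fderiv_smul μ hUo.measurableSet hFd
      hinj.injOn (fun _ => (1:ℝ))
    rw [himg] at hI hI2
    have hfin : μ U ≠ ⊤ := measure_ball_lt_top.ne
    constructor
    · refine (hI2.1 (integrableOn_const hfin)).congr_fun ?_ hUo.measurableSet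
      intro x hx
      simp [hpos x hx]
    · rw [setIntegral_const] at hI
      rw [smul_eq_mul, mul_one] at hI
      rw [hI]
      refine setIntegral_congr_fun hUo.measurableSet fun x hx => ?_
      simp [hpos x hx]
  obtain ⟨c, hc1, hc⟩ := pm_det_interp hdd (fun i => τ * ((i : ℕ) : ℝ) / (d + 1)) (by
    intro i j hij
    have : ((i:ℕ):ℝ) = ((j:ℕ):ℝ) := by
      have : (d:ℝ) + 1 ≠ 0 := by positivity
      field_simp at hij
      exact hij
    exact Fin.ext (by exact_mod_cast this))
  have hv : ∀ i : Fin (d+1), 0 ≤ τ * ((i : ℕ) : ℝ) / (d + 1) ∧ τ * ((i : ℕ) : ℝ) / (d + 1) < τ := by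
    intro i
    refine ⟨by positivity, ?_⟩
    rw [div_lt_iff₀ (by positivity)]
    have : ((i:ℕ):ℝ) < d + 1 := by exact_mod_cast i.2
    nlinarith
  have hfinal : ∫ x in U, (ContinuousLinearMap.id ℝ E + g' x).det ∂μ = μ.real U := by
    rw [show (fun x => (ContinuousLinearMap.id ℝ E + g' x).det) = _ from funext fun x => hc (g' x)]
    rw [integral_finsetSum]
    · simp_rw [integral_const_mul]
      rw [Finset.sum_congr rfl (fun i _ => by rw [(main _ (hv i).1 (hv i).2).2]),
        ← Finset.sum_mul, hc1, one_mul]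
    · intro i _
      exact (main _ (hv i).1 (hv i).2).1.const_mul _
  have hzero : ∀ x ∈ U, (ContinuousLinearMap.id ℝ E + g' x).det = 0 := by
    intro x hx
    have hx' : ‖x‖ < 1 := by simpa [hU] using hx
    have : ContinuousLinearMap.id ℝ E + g' x = fderiv ℝ f x := by simp [g']
    rw [this]
    by_contra hne
    have horth : ∀ v, inner ℝ (f x) (fderiv ℝ f x v) = 0 := by
      intro v
      have hfd := (hd x hx').hasFDerivAt
      have h2 := hfd.norm_sq
      have h3 : HasFDerivAt (fun y => ‖f y‖^2) (0 : E →L[ℝ] ℝ) x := by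
        refine (hasFDerivAt_const (1:ℝ) x).congr_of_eventuallyEq ?_
        filter_upwards [hUo.mem_nhds hx] with y hy
        have hy' : ‖y‖ < 1 := by simpa [hU] using hy
        simp [h1 y hy']
      have h4 := congrArg (fun L : E →L[ℝ] ℝ => L v) (h2.unique h3)
      simpa using h4
    have hsurj : Function.Surjective (fderiv ℝ f x) := by
      have hu : IsUnit (LinearMap.det (fderiv ℝ f x : E →ₗ[ℝ] E)) := isUnit_iff_ne_zero.2 hne
      have hu2 : IsUnit (fderiv ℝ f x : E →ₗ[ℝ] E) := LinearMap.isUnit_iff_isUnit_det _ |>.2 hu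
      exact ((Module.End.isUnit_iff _).1 hu2).2
    obtain ⟨v, hv⟩ := hsurj (f x)
    have := horth v
    rw [hv, real_inner_self_eq_norm_sq, h1 x hx'] at this
    norm_num at this
  rw [setIntegral_congr_fun hUo.measurableSet (g := fun _ => (0:ℝ)) (fun x hx => hzero x hx)] at hfinal
  have hvol : 0 < μ U := Metric.measure_ball_pos _ _ one_pos
  have : 0 < μ.real U := ENNReal.toReal_pos hvol.ne' measure_ball_lt_top.ne
  simp at hfinal
  linarith

open scoped ContDiff Manifold in
lemma pm_smooth_approx {E : Type*} [NormedAddCommGroup E] [InnerProductSpace ℝ E]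
    [FiniteDimensional ℝ E] (h : E → E) (hc : Continuous h) (ε : ℝ) (hε : 0 < ε) :
    ∃ p : E → E, ContDiff ℝ 1 p ∧ ∀ x, ‖p x - h x‖ < ε := by
  obtain ⟨p, hp⟩ := exists_contMDiffMap_forall_mem_convex_of_local_const (n := 1) (F := E) 𝓘(ℝ, E)
    (t := fun x => Metric.ball (h x) ε) (fun x => convex_ball _ _) (by
      intro x
      refine ⟨h x, ?_⟩
      filter_upwards [hc.continuousAt.eventually (Metric.ball_mem_nhds (h x) hε)] with y hy
      rw [Metric.mem_ball, dist_comm]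
      exact hy)
  refine ⟨p, p.contMDiff.contDiff, fun x => ?_⟩
  have := hp x
  rwa [Metric.mem_ball, dist_eq_norm] at this

open scoped ContDiff Manifold in
lemma pm_cutoff {E : Type*} [NormedAddCommGroup E] [InnerProductSpace ℝ E]
    [FiniteDimensional ℝ E] (s t : Set E) (hs : IsClosed s) (ht : IsClosed t) (hd : Disjoint s t) :
    ∃ c : E → ℝ, ContDiff ℝ 1 c ∧ (∀ x ∈ s, c x = 0) ∧ (∀ x ∈ t, c x = 1) ∧
      ∀ x, 0 ≤ c x ∧ c x ≤ 1 := by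
  obtain ⟨c, h0, h1, h⟩ := exists_contMDiffMap_zero_one_of_isClosed (n := 1) 𝓘(ℝ, E) hs ht hd
  exact ⟨c, c.contMDiff.contDiff, fun x hx => h0 hx, fun x hx => h1 hx, fun x => h x⟩

theorem pm_acute_unit {E : Type*} [NormedAddCommGroup E] [InnerProductSpace ℝ E]
    [FiniteDimensional ℝ E] (h : E → E) (hc : Continuous h)
    (hpos : ∀ x, ‖x‖ = 1 → 0 < inner ℝ (h x) x) : ∃ x, ‖x‖ ≤ 1 ∧ h x = 0 := by
  by_contra! hne
  have hcpt : IsCompact (Metric.closedBall (0:E) 1) := isCompact_closedBall _ _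
  have hcpt' : IsCompact (Metric.sphere (0:E) 1) := isCompact_sphere _ _
  obtain ⟨ε₁, hε₁, he₁⟩ : ∃ ε > 0, ∀ x, ‖x‖ ≤ 1 → ε ≤ ‖h x‖ := by
    obtain ⟨x, hx, hm⟩ := hcpt.exists_isMinOn ⟨0, by simp⟩ hc.norm.continuousOn
    refine ⟨‖h x‖, norm_pos_iff.2 (hne x (by simpa using hx)), fun y hy => hm (by simpa using hy)⟩
  obtain ⟨ε₂, hε₂, he₂⟩ : ∃ ε > 0, ∀ x, ‖x‖ = 1 → ε ≤ inner ℝ (h x) x := by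
    rcases (Metric.sphere (0:E) 1).eq_empty_or_nonempty with h0 | h0
    · refine ⟨1, one_pos, fun x hx => ?_⟩
      have : x ∈ Metric.sphere (0:E) 1 := by simpa using hx
      rw [h0] at this; exact this.elim
    · obtain ⟨x, hx, hm⟩ := hcpt'.exists_isMinOn h0
        (f := fun x => inner ℝ (h x) x) (by fun_prop)
      refine ⟨_, hpos x (by simpa using hx), fun y hy => hm (by simpa using hy)⟩
  obtain ⟨p, hpd, hp⟩ := pm_smooth_approx h hc (min ε₁ ε₂) (lt_min hε₁ hε₂)
  have hp0 : ∀ x, ‖x‖ ≤ 1 → p x ≠ 0 := by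
    intro x hx h0
    have := hp x
    rw [h0, zero_sub, norm_neg] at this
    linarith [he₁ x hx, min_le_left ε₁ ε₂]
  have hpp : ∀ x, ‖x‖ = 1 → 0 < inner ℝ (p x) x := by
    intro x hx
    have h1 : inner ℝ (p x) x = inner ℝ (h x) x + inner ℝ (p x - h x) x := by
      rw [← inner_add_left]; simp
    have h2 := abs_real_inner_le_norm (p x - h x) x
    rw [hx, mul_one] at h2
    have h3 := (abs_le.1 h2).1
    linarith [he₂ x hx, min_le_right ε₁ ε₂, hp x]
  have hpc := hpd.continuous
  obtain ⟨c, hcd, hc0, hc1, hcr⟩ := pm_cutoff (Metric.sphere (0:E) 1)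
    {x | inner ℝ (p x) x ≤ 0} Metric.isClosed_sphere
    (isClosed_le (by fun_prop) continuous_const) (by
      rw [Set.disjoint_left]
      intro x hx hx'
      exact absurd (hpp x (by simpa using hx)) (not_lt.2 hx'))
  let q : E → E := fun x => c x • p x + (1 - c x) • x
  have hqd : ContDiff ℝ 1 q := by fun_prop
  have hq0 : ∀ x, ‖x‖ ≤ 1 → q x ≠ 0 := by
    intro x hx h0
    by_cases hk : inner ℝ (p x) x ≤ 0
    · have : q x = p x := by simp [q, hc1 x hk]
      exact hp0 x hx (this ▸ h0)
    · push Not at hk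
      have hx0 : x ≠ 0 := by rintro rfl; simp at hk
      have h1 : inner ℝ (q x) x = c x * inner ℝ (p x) x + (1 - c x) * ‖x‖^2 := by
        simp only [q, inner_add_left, real_inner_smul_left, real_inner_self_eq_norm_sq]
      rw [h0, inner_zero_left] at h1
      have h2 : 0 < ‖x‖^2 := by positivity
      have h3 := hcr x
      rcases h3.1.eq_or_lt with h4 | h4
      · rw [← h4] at h1; linarith
      · have := mul_pos h4 hk
        have := mul_nonneg (sub_nonneg.2 h3.2) h2.le
        linarith
  have hfd : ∀ x, ‖x‖ ≤ 1 → ContDiffAt ℝ 1 (fun x => ‖q x‖⁻¹ • q x) x := by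
    intro x hx
    exact ((hqd.contDiffAt.norm ℝ (hq0 x hx)).inv (norm_ne_zero_iff.2 (hq0 x hx))).smul
      hqd.contDiffAt
  obtain ⟨K, hK⟩ := ContDiffOn.exists_lipschitzOnWith (n := 1) (f := fun x => ‖q x‖⁻¹ • q x)
    (s := Metric.closedBall (0:E) 1)
    (fun x hx => (hfd x (by simpa using hx)).contDiffWithinAt) one_ne_zero
    (convex_closedBall _ _) hcpt
  borelize E
  refine pm_no_retraction MeasureTheory.Measure.addHaar _ K hK
    (fun x hx => (hfd x hx.le).differentiableAt one_ne_zero) ?_ ?_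
  · intro x hx
    rw [norm_smul, norm_inv, norm_norm, inv_mul_cancel₀ (norm_ne_zero_iff.2 (hq0 x hx.le))]
  · intro x hx
    have : q x = x := by simp [q, hc0 x (by simpa using hx)]
    simp [this, hx]

theorem pm_acute {E : Type*} [NormedAddCommGroup E] [InnerProductSpace ℝ E]
    [FiniteDimensional ℝ E] (h : E → E) (hc : Continuous h) (r : ℝ) (hr : 0 < r)
    (hpos : ∀ x, ‖x‖ = r → 0 < inner ℝ (h x) x) : ∃ x, h x = 0 := by
  obtain ⟨x, -, hx⟩ := pm_acute_unit (fun x => h (r • x)) (by fun_prop) (by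
    intro x hx
    have := hpos (r • x) (by rw [norm_smul, hx, Real.norm_eq_abs, abs_of_pos hr, mul_one])
    rw [real_inner_smul_right] at this
    exact pos_of_mul_pos_right this hr.le)
  exact ⟨_, hx⟩

/-- Galerkin solvability on finite-dimensional subspaces. -/
theorem pm_galerkin {X : Type*} [NormedAddCommGroup X] [NormedSpace ℝ X]
    (B : X → X →L[ℝ] ℝ) (hB : ∀ v, Continuous fun u => B u v) (R : ℝ)
    (hR : ∀ u, R ≤ ‖u‖ → 0 < B u u) (F : Submodule ℝ X) [FiniteDimensional ℝ F] :
    ∃ u ∈ F, ‖u‖ < R ∧ ∀ v ∈ F, B u v = 0 := by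
  let n := Module.finrank ℝ F
  have e : EuclideanSpace ℝ (Fin n) ≃L[ℝ] F :=
    ContinuousLinearEquiv.ofFinrankEq (by simp [n])
  let h : EuclideanSpace ℝ (Fin n) → EuclideanSpace ℝ (Fin n) := fun x =>
    WithLp.toLp 2 fun i => B (e x : X) (e (EuclideanSpace.single i 1) : X)
  have hin : ∀ x y, inner ℝ (h x) y = B (e x : X) (e y : X) := by
    intro x y
    conv_rhs => rw [← (EuclideanSpace.basisFun (Fin n) ℝ).sum_repr y]
    simp [h, PiLp.inner_apply]
  have hcont : Continuous h := by
    refine (PiLp.continuous_toLp 2 _).comp (continuous_pi fun i => ?_)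
    exact (hB _).comp (continuous_subtype_val.comp e.continuous)
  let N : ℝ := ‖(e.symm : F →L[ℝ] EuclideanSpace ℝ (Fin n))‖
  have hN : ∀ x, ‖x‖ ≤ N * ‖(e x : X)‖ := by
    intro x
    have := (e.symm : F →L[ℝ] EuclideanSpace ℝ (Fin n)).le_opNorm (e x)
    simpa using this
  obtain ⟨x, hx⟩ := pm_acute h hcont (N * |R| + 1) (by positivity) (by
    intro x hx
    rw [hin]
    apply hR
    have h1 := hN x
    rw [hx] at h1
    by_contra hlt
    push Not at hlt
    have : N * ‖(e x : X)‖ ≤ N * |R| := by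
      gcongr
      exact hlt.le.trans (le_abs_self R)
    linarith)
  have hz : ∀ v ∈ F, B (e x : X) v = 0 := by
    intro v hv
    have := hin x (e.symm ⟨v, hv⟩)
    rw [hx] at this
    simpa using this.symm
  refine ⟨e x, (e x).2, ?_, hz⟩
  by_contra hlt
  have := hR _ (not_lt.1 hlt)
  rw [hz _ (e x).2] at this
  exact lt_irrefl _ this

lemma pm_norming {D : Type*} [NormedAddCommGroup D] [NormedSpace ℝ D] (S : Set (D →L[ℝ] ℝ))
    (hS : TopologicalSpace.IsSeparable S) :
    ∃ C : ℕ → D, (∀ k, ‖C k‖ ≤ 1) ∧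
      ∀ η ∈ S, ∀ c : ℝ, (∀ k, |η (C k)| ≤ c) → ‖η‖ ≤ 2 * c := by
  obtain ⟨Q, hQ, hSQ⟩ := hS
  obtain ⟨e, he⟩ := (hQ.insert 0).exists_eq_range (Set.insert_nonempty 0 Q)
  have hex : ∀ η : D →L[ℝ] ℝ, ∃ ψ : D, ‖ψ‖ ≤ 1 ∧ ‖η‖ / 2 ≤ |η ψ| := by
    intro η
    by_cases h0 : η = 0
    · exact ⟨0, by simp, by simp [h0]⟩
    · have hp : 0 < ‖η‖ := norm_pos_iff.2 h0
      obtain ⟨ψ, h1, h2⟩ := η.exists_lt_apply_of_lt_opNorm (half_lt_self hp)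
      exact ⟨ψ, h1.le, h2.le⟩
  choose ψ hψ1 hψ2 using hex
  refine ⟨fun k => ψ (e k), fun k => hψ1 _, ?_⟩
  intro η hη c hc
  refine le_of_forall_pos_le_add fun ε hε => ?_
  have hcl : η ∈ closure Q := hSQ hη
  obtain ⟨ζ, hζ, hd⟩ := Metric.mem_closure_iff.1 hcl (ε / 3) (by positivity)
  obtain ⟨j, rfl⟩ : ζ ∈ Set.range e := he ▸ Set.mem_insert_of_mem 0 hζ
  rw [dist_eq_norm] at hd
  have h1 : ‖η‖ ≤ ‖e j‖ + ‖η - e j‖ := by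
    have := norm_add_le (e j) (η - e j)
    simpa using this
  have h2 := hψ2 (e j)
  have h3 : |(η - e j) (ψ (e j))| ≤ ‖η - e j‖ := by
    have := (η - e j).le_opNorm (ψ (e j))
    refine this.trans (mul_le_of_le_one_right (norm_nonneg _) (hψ1 _))
  have h4 := hc j
  have h5 : |e j (ψ (e j))| ≤ |η (ψ (e j))| + |(η - e j) (ψ (e j))| := by
    have := abs_sub (η (ψ (e j))) ((η - e j) (ψ (e j)))
    simpa using this
  linarith

/-- A Whitley-style argument for the Eberlein–Shmulian theorem. -/
theorem pm_eberlein {X : Type*} [NormedAddCommGroup X] [NormedSpace ℝ X]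
    (hrefl : ∀ u : ℕ → X, Bornology.IsBounded (Set.range u) →
      ∃ (w : X) (φ : ℕ → ℕ), StrictMono φ ∧
        ∀ ψ : X →L[ℝ] ℝ, Tendsto (fun n => ψ (u (φ n))) atTop (𝓝 (ψ w)))
    {ι : Type*} (l : Filter ι) [l.NeBot] (u : ι → X) (R : ℝ) (hb : ∀ i, ‖u i‖ ≤ R)
    (Φ : (X →L[ℝ] ℝ) →L[ℝ] ℝ) (hΦ : ∀ ψ : X →L[ℝ] ℝ, Tendsto (fun i => ψ (u i)) l (𝓝 (Φ ψ)))
    (s : Set ι) (hs : s ∈ l) :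
    ∃ w : X, (∀ ψ : X →L[ℝ] ℝ, Φ ψ = ψ w) ∧ ∃ i : ℕ → ι, (∀ n, i n ∈ s) ∧
      ∀ ψ : X →L[ℝ] ℝ, Tendsto (fun n => ψ (u (i n))) atTop (𝓝 (ψ w)) := by
  classical
  let J := NormedSpace.inclusionInDoubleDual ℝ X
  have hsep : ∀ T : Finset ι, TopologicalSpace.IsSeparable
      ((fun z => Φ - J z) '' (Submodule.span ℝ (u '' (T : Set ι)) : Set X)) := by
    intro T
    refine TopologicalSpace.IsSeparable.image ?_ (continuous_const.sub J.continuous)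
    exact ((T.finite_toSet.image u).isSeparable).span
  choose C hC1 hC2 using fun T => pm_norming _ (hsep T)
  have hstep : ∀ (n : ℕ) (T : Finset ι), ∃ i ∈ s, ∀ T' ∈ T.powerset, ∀ k ∈ Finset.range (n+1),
      dist (C T' k (u i)) (Φ (C T' k)) < 1 / ((n:ℝ) + 1) := by
    intro n T
    have : ∀ᶠ i in l, i ∈ s ∧ ∀ T' ∈ T.powerset, ∀ k ∈ Finset.range (n+1),
        dist (C T' k (u i)) (Φ (C T' k)) < 1 / ((n:ℝ) + 1) := by
      refine Filter.Eventually.and hs ?_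
      rw [Filter.eventually_all_finset]
      intro T' _
      rw [Filter.eventually_all_finset]
      intro k _
      exact (hΦ (C T' k)).eventually (Metric.ball_mem_nhds _ (by positivity))
    obtain ⟨i, h1, h2⟩ := this.exists
    exact ⟨i, h1, h2⟩
  choose next hn1 hn2 using hstep
  obtain ⟨T, hTs⟩ : ∃ T : ℕ → Finset ι, ∀ n, T (n+1) = insert (next n (T n)) (T n) :=
    ⟨fun n => Nat.rec ∅ (fun n T => insert (next n T) T) n, fun n => rfl⟩
  have hTm : Monotone T := monotone_nat_of_le_succ fun n => by
    rw [hTs]; exact Finset.subset_insert _ _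
  let i : ℕ → ι := fun n => next n (T n)
  have hiT : ∀ n, i n ∈ T (n+1) := fun n => by rw [hTs]; exact Finset.mem_insert_self _ _
  obtain ⟨w, φ, hφ, hw⟩ := hrefl (fun n => u (i n)) (by
    rw [isBounded_iff_forall_norm_le]
    refine ⟨R, ?_⟩
    rintro _ ⟨n, rfl⟩
    exact hb _)
  have hlim : ∀ m k, Tendsto (fun n => C (T m) k (u (i n))) atTop (𝓝 (Φ (C (T m) k))) := by
    intro m k
    rw [tendsto_iff_dist_tendsto_zero]
    refine squeeze_zero' (Eventually.of_forall fun _ => dist_nonneg) ?_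
      (tendsto_one_div_add_atTop_nhds_zero_nat (𝕜 := ℝ))
    filter_upwards [eventually_ge_atTop m, eventually_ge_atTop k] with n hm hk
    exact (hn2 n (T n) (T m) (Finset.mem_powerset.2 (hTm hm)) k
      (Finset.mem_range.2 (Nat.lt_succ_of_le hk))).le
  have hwC : ∀ m k, Φ (C (T m) k) = C (T m) k w := fun m k =>
    tendsto_nhds_unique ((hlim m k).comp hφ.tendsto_atTop) (hw _)
  let V : ℕ → Submodule ℝ X := fun m => Submodule.span ℝ (u '' ((T m : Finset ι) : Set ι))
  let W : Submodule ℝ X := iSup V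
  have hTm' : ∀ a b, a ≤ b → ((T a : Finset ι) : Set ι) ⊆ ((T b : Finset ι) : Set ι) :=
    fun a b hab => Finset.coe_subset.2 (hTm hab)
  have hdir : Directed (· ≤ ·) fun m : ℕ => Submodule.span ℝ (u '' ((T m : Finset ι) : Set ι)) :=
    Monotone.directed_le fun a b hab => Submodule.span_mono (Set.image_mono (hTm' a b hab))
  have huW : ∀ n, u (i n) ∈ W := fun n =>
    (le_iSup (fun m : ℕ => Submodule.span ℝ (u '' ((T m : Finset ι) : Set ι))) (n+1))
      (Submodule.subset_span ⟨i n, by exact_mod_cast hiT n, rfl⟩)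
  have hwW : w ∈ closure (W : Set X) := by
    by_contra hnot
    obtain ⟨f, a, hf1, hf2⟩ := geometric_hahn_banach_closed_point
      (W.convex.closure) isClosed_closure hnot
    have : f w ≤ a := le_of_tendsto (hw f)
      (Eventually.of_forall fun n => (hf1 _ (subset_closure (huW _))).le)
    linarith
  have hΦw : Φ = J w := by
    suffices hn : ‖Φ - J w‖ ≤ 0 from
      sub_eq_zero.1 ((ContinuousLinearMap.opNorm_zero_iff (f := Φ - J w)).1
        (le_antisymm hn (ContinuousLinearMap.opNorm_nonneg _)))
    refine le_of_forall_pos_le_add fun ε hε => ?_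
    obtain ⟨z, hz, hd⟩ := Metric.mem_closure_iff.1 hwW (ε / 3) (by positivity)
    obtain ⟨m, hm⟩ := (Submodule.mem_iSup_of_directed _ hdir).1 hz
    rw [dist_eq_norm] at hd
    have hJ : ∀ x, ‖J x‖ ≤ ‖x‖ := NormedSpace.double_dual_bound ℝ X
    have h1 := hC2 (T m) (Φ - J z) ⟨z, hm, rfl⟩ (ε / 3) (by
      intro k
      have : (Φ - J z) (C (T m) k) = C (T m) k (w - z) := by
        simp [J, hwC]
      rw [this]
      refine ((C (T m) k).le_opNorm _).trans ?_
      exact (mul_le_of_le_one_left (norm_nonneg _) (hC1 _ _)).trans hd.le)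
    have h2 : Φ - J w = (Φ - J z) - J (w - z) := by rw [map_sub]; abel
    have h3 := norm_sub_le (Φ - J z) (J (w - z))
    have h4 := hJ (w - z)
    rw [h2]
    linarith
  exact ⟨w, fun ψ => by rw [hΦw]; rfl, fun n => i (φ n), fun n => hn1 _ _, hw⟩

lemma pm_limit_functional {X : Type*} [NormedAddCommGroup X] [NormedSpace ℝ X]
    {ι : Type*} (l : Ultrafilter ι) (u : ι → X) (R : ℝ) (hb : ∀ i, ‖u i‖ ≤ R) :
    ∃ Φ : (X →L[ℝ] ℝ) →L[ℝ] ℝ, ∀ ψ : X →L[ℝ] ℝ, Tendsto (fun i => ψ (u i)) l (𝓝 (Φ ψ)) := by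
  have hbd : ∀ (ψ : X →L[ℝ] ℝ) i, ‖ψ (u i)‖ ≤ R * ‖ψ‖ := fun ψ i => by
    rw [mul_comm]; exact ψ.le_of_opNorm_le_of_le le_rfl (hb i)
  have hex : ∀ ψ : X →L[ℝ] ℝ, ∃ a ∈ Metric.closedBall (0:ℝ) (R * ‖ψ‖),
      Tendsto (fun i => ψ (u i)) l (𝓝 a) := by
    intro ψ
    obtain ⟨a, ha, h⟩ := (isCompact_closedBall (0:ℝ) (R * ‖ψ‖)).ultrafilter_le_nhds
      (l.map fun i => ψ (u i)) (by
        rw [le_principal_iff]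
        exact Filter.mem_map.2 (Filter.univ_mem' fun i => by simpa using hbd ψ i))
    exact ⟨a, ha, h⟩
  choose Φ hΦ1 hΦ2 using hex
  let L : (X →L[ℝ] ℝ) →ₗ[ℝ] ℝ :=
    { toFun := Φ
      map_add' := fun a b => tendsto_nhds_unique (hΦ2 (a + b)) (by
        simpa using (hΦ2 a).add (hΦ2 b))
      map_smul' := fun c a => tendsto_nhds_unique (hΦ2 (c • a)) (by
        simpa using (hΦ2 a).const_mul c) }
  exact ⟨L.mkContinuous R fun ψ => by simpa using! hΦ1 ψ, hΦ2⟩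

/-- Surjectivity of pseudomonotone, bounded and coercive operators on a real reflexive
Banach space (reflexivity is encoded by the weak sequential compactness of bounded
sequences, and weak convergence is expressed through the dual). -/
theorem pseudomonotone_surjective
    {X : Type*} [NormedAddCommGroup X] [NormedSpace ℝ X] [CompleteSpace X]
    -- reflexivity: every bounded sequence has a weakly convergent subsequence:
    (hrefl : ∀ u : ℕ → X, Bornology.IsBounded (Set.range u) →
      ∃ (w : X) (φ : ℕ → ℕ), StrictMono φ ∧
        ∀ ψ : X →L[ℝ] ℝ, Tendsto (fun n => ψ (u (φ n))) atTop (𝓝 (ψ w)))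
    (A : X → X →L[ℝ] ℝ)
    -- A is pseudomonotone:
    (hpm : ∀ (u : ℕ → X) (w : X),
      (∀ ψ : X →L[ℝ] ℝ, Tendsto (fun n => ψ (u n)) atTop (𝓝 (ψ w))) →
      limsup (fun n => (A (u n)) (u n - w)) atTop ≤ 0 →
      (∀ x : X, Tendsto (fun n => (A (u n)) x) atTop (𝓝 ((A w) x))) ∧
      Tendsto (fun n => (A (u n)) (u n)) atTop (𝓝 ((A w) w)))
    -- A is bounded (maps bounded sets to bounded sets):
    (hbdd : ∀ s : Set X, Bornology.IsBounded s → Bornology.IsBounded (A '' s))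
    -- A is coercive: ⟨A(u), u⟩ / ‖u‖ → ∞ as ‖u‖ → ∞:
    (hcoer : Tendsto (fun u : X => (A u) u / ‖u‖) (Bornology.cobounded X) atTop) :
    ∀ b : X →L[ℝ] ℝ, ∃ u : X, A u = b := by
  intro b
  -- strong-to-weak continuity of A
  have hcont : ∀ v, Continuous fun u => A u v := by
    intro v
    rw [continuous_iff_seqContinuous]
    intro x w hx
    refine (hpm x w (fun ψ => (ψ.continuous.tendsto w).comp hx) ?_).1 v
    have hlim : Tendsto (fun n => (A (x n)) (x n - w)) atTop (𝓝 0) := by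
      obtain ⟨M, hM⟩ := isBounded_iff_forall_norm_le.1
        (hbdd _ (Metric.isBounded_range_of_tendsto x hx))
      have h0 : Tendsto (fun n => M * ‖x n - w‖) atTop (𝓝 0) := by
        have := (tendsto_iff_norm_sub_tendsto_zero.1 hx).const_mul M
        simpa using this
      refine squeeze_zero_norm (fun n => ?_) h0
      exact (A (x n)).le_of_opNorm_le (hM _ ⟨x n, ⟨n, rfl⟩, rfl⟩) _
    exact hlim.limsup_eq.le
  -- a priori bound
  obtain ⟨R, hR⟩ : ∃ R : ℝ, ∀ u : X, R ≤ ‖u‖ → 0 < (A u - b) u := by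
    have h1 := hcoer.eventually (eventually_ge_atTop (‖b‖ + 1))
    have h2 : {u : X | ‖b‖ + 1 ≤ A u u / ‖u‖} ∈ Bornology.cobounded X := h1
    rw [← comap_norm_atTop, Filter.mem_comap] at h2
    obtain ⟨t, ht, hts⟩ := h2
    obtain ⟨a, ha⟩ := mem_atTop_sets.1 ht
    refine ⟨max a 1, fun u hu => ?_⟩
    have hu1 : (0:ℝ) < ‖u‖ := lt_of_lt_of_le one_pos ((le_max_right a 1).trans hu)
    have h3 : ‖b‖ + 1 ≤ A u u / ‖u‖ := hts (ha _ ((le_max_left a 1).trans hu))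
    rw [le_div_iff₀ hu1] at h3
    have h4 : b u ≤ ‖b‖ * ‖u‖ := (le_abs_self _).trans (b.le_opNorm u)
    rw [sub_apply]
    linarith
  -- Galerkin solutions
  have hgal : ∀ T : Finset X, ∃ u ∈ Submodule.span ℝ (T : Set X), ‖u‖ < R ∧
      ∀ v ∈ Submodule.span ℝ (T : Set X), (A u - b) v = 0 := by
    intro T
    exact pm_galerkin (fun u => A u - b)
      (fun v => (hcont v).sub continuous_const) R hR _
  choose u hu1 hu2 hu3 using hgal
  let l : Ultrafilter (Finset X) := Ultrafilter.of atTop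
  have hl : (l : Filter (Finset X)) ≤ atTop := Ultrafilter.of_le _
  obtain ⟨Φ, hΦ⟩ := pm_limit_functional l u R fun T => (hu2 T).le
  obtain ⟨w, hw, -⟩ := pm_eberlein hrefl (l : Filter (Finset X)) u R (fun T => (hu2 T).le) Φ hΦ
    Set.univ univ_mem
  refine ⟨w, ?_⟩
  ext v
  classical
  obtain ⟨w', hw', i, hi, hlim⟩ := pm_eberlein hrefl (l : Filter (Finset X)) u R
    (fun T => (hu2 T).le) Φ hΦ {T | {w, v} ≤ T} (hl (mem_atTop _))
  have hlim' : ∀ ψ : X →L[ℝ] ℝ, Tendsto (fun n => ψ (u (i n))) atTop (𝓝 (ψ w)) := by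
    intro ψ
    rw [← hw ψ, hw' ψ]
    exact hlim ψ
  have hwi : ∀ n, w ∈ Submodule.span ℝ (i n : Set X) := fun n =>
    Submodule.subset_span (by exact_mod_cast hi n (by simp))
  have hvi : ∀ n, v ∈ Submodule.span ℝ (i n : Set X) := fun n =>
    Submodule.subset_span (by exact_mod_cast hi n (by simp))
  have heq : ∀ n, ∀ x ∈ Submodule.span ℝ (i n : Set X), A (u (i n)) x = b x := by
    intro n x hx
    have := hu3 (i n) x hx
    rw [sub_apply] at this
    linarith
  have hls : limsup (fun n => (A (u (i n))) (u (i n) - w)) atTop ≤ 0 := by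
    have : Tendsto (fun n => (A (u (i n))) (u (i n) - w)) atTop (𝓝 0) := by
      have h1 : (fun n => (A (u (i n))) (u (i n) - w)) = fun n => b (u (i n)) - b w := by
        funext n
        rw [heq n _ (Submodule.sub_mem _ (hu1 _) (hwi n)), map_sub]
      rw [h1]
      simpa using (hlim' b).sub_const (b w)
    exact this.limsup_eq.le
  have hfin := (hpm (fun n => u (i n)) w hlim' hls).1 v
  have hconst : (fun n => A (u (i n)) v) = fun _ => b v := funext fun n => heq n v (hvi n)
  rw [hconst] at hfin
  exact tendsto_nhds_unique hfin tendsto_const_nhds |>.symm ▸ rfl
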